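/- In the clipping ANN setting, let Θ ∈ C([0, ∞), ℝ^{h+1}) be a gradient flow trajectory and let k ∈ {1, …, h} satisfy I_k^{Θ_0} ≠ ∅. Then for all t ∈ [0, ∞) it holds that I_k^{Θ_t} ≠ ∅. -/

import Mathlib

open MeasureTheory Filter

noncomputable section

/-- The clipping function `x ↦ min{max{x,0},1}`. -/
def clipFn (x : ℝ) : ℝ := min (max x 0) 1

/-- `ψ_i(θ) = -θ_i / w_i`. -/
def psiC {h : ℕ} (w : Fin h → ℝ) (θ : Fin (h + 1) → ℝ) (i : Fin h) : ℝ :=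
  -θ i.castSucc / w i

/-- The activity interval `I_i^θ = (ψ_i(θ), ψ_i(θ) + 1/w_i) ∩ (a, b)`. -/
def actI {h : ℕ} (a b : ℝ) (w : Fin h → ℝ) (θ : Fin (h + 1) → ℝ) (i : Fin h) : Set ℝ :=
  Set.Ioo (psiC w θ i) (psiC w θ i + (w i)⁻¹) ∩ Set.Ioo a b

/-- The realization function `N^θ(x) = θ_{h+1} + ∑_i v_i c(w_i x + θ_i)`. -/
def realC {h : ℕ} (v w : Fin h → ℝ) (θ : Fin (h + 1) → ℝ) (x : ℝ) : ℝ :=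
  θ (Fin.last h) + ∑ i : Fin h, v i * clipFn (w i * x + θ i.castSucc)

/-- The risk `L(θ) = ∫_a^b (N^θ(x) - f(x))² p(x) dx`. -/
def riskC {h : ℕ} (a b : ℝ) (v w : Fin h → ℝ) (f p : ℝ → ℝ) (θ : Fin (h + 1) → ℝ) : ℝ :=
  ∫ x in Set.Ioo a b, (realC v w θ x - f x) ^ 2 * p x

/-- The gradient `∇L(θ)` as a vector of partial derivatives. -/
def gradC {h : ℕ} (a b : ℝ) (v w : Fin h → ℝ) (f p : ℝ → ℝ) (θ : Fin (h + 1) → ℝ) :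
    Fin (h + 1) → ℝ :=
  fun k => fderiv ℝ (riskC a b v w f p) θ (Pi.single k 1)

/-- `x` is a descending critical point of `g` : `∇g(x) = 0` and the Hessian quadratic form
admits a negative value. -/
def IsDescCrit {n : ℕ} (g : (Fin n → ℝ) → ℝ) (x : Fin n → ℝ) : Prop :=
  fderiv ℝ g x = 0 ∧ ∃ u : Fin n → ℝ, iteratedFDeriv ℝ 2 g x ![u, u] < 0

/-- The Euclidean norm on `Fin n → ℝ`. -/
def euclNorm {n : ℕ} (x : Fin n → ℝ) : ℝ := Real.sqrt (∑ i, (x i) ^ 2)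

/-- Piecewise polynomial functions. -/
def PiecewisePoly (F : ℝ → ℝ) : Prop :=
  ∃ (K : ℕ) (τ : ℕ → EReal), 0 < K ∧ τ 0 = ⊥ ∧ τ K = ⊤ ∧
    (∀ k, k < K → τ k < τ (k + 1)) ∧
    ∀ k, k < K → ∃ q : Polynomial ℝ, ∀ x : ℝ,
      τ k < (x : EReal) → (x : EReal) < τ (k + 1) → F x = q.eval x

open Set Topology

theorem clipFn_nonneg (x : ℝ) : 0 ≤ clipFn x := le_min (le_max_right _ _) zero_le_one

theorem clipFn_le_one (x : ℝ) : clipFn x ≤ 1 := min_le_right _ _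

theorem continuous_clipFn : Continuous clipFn := by
  unfold clipFn; fun_prop

theorem abs_clipFn_add_sub_le (x s : ℝ) : |clipFn (x + s) - clipFn x| ≤ |s| := by
  unfold clipFn; grind

theorem clipFn_add_eq_of_le {x s : ℝ} (hx : x ≤ -|s|) : clipFn (x + s) = clipFn x := by
  unfold clipFn; grind

theorem clipFn_add_eq_of_ge {x s : ℝ} (hx : 1 + |s| ≤ x) : clipFn (x + s) = clipFn x := by
  unfold clipFn; grind

theorem continuous_realC {h : ℕ} (v w : Fin h → ℝ) (θ : Fin (h + 1) → ℝ) :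
    Continuous (realC v w θ) := by
  unfold realC
  have := continuous_clipFn
  fun_prop

theorem abs_realC_le {h : ℕ} {v : Fin h → ℝ} (hv : ∀ i, 0 < v i) (w : Fin h → ℝ)
    (θ : Fin (h + 1) → ℝ) (x : ℝ) : |realC v w θ x| ≤ ‖θ‖ + ∑ i, v i := by
  unfold realC
  refine (abs_add_le _ _).trans (add_le_add (norm_le_pi_norm θ _) ?_)
  refine (Finset.abs_sum_le_sum_abs _ _).trans (Finset.sum_le_sum fun i _ => ?_)
  rw [abs_of_nonneg (mul_nonneg (hv i).le (clipFn_nonneg _))]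
  exact mul_le_of_le_one_right (hv i).le (clipFn_le_one _)

/-- Shifting the bias of the `k`-th neuron only affects the `k`-th summand. -/
theorem realC_add_single_sub {h : ℕ} (v w : Fin h → ℝ) (θ : Fin (h + 1) → ℝ) (k : Fin h)
    (s x : ℝ) :
    realC v w (θ + s • Pi.single k.castSucc 1) x - realC v w θ x =
      v k * (clipFn (w k * x + θ k.castSucc + s) - clipFn (w k * x + θ k.castSucc)) := by
  unfold realC
  have hlast : (Pi.single k.castSucc (1 : ℝ) : Fin (h + 1) → ℝ) (Fin.last h) = 0 :=
    Pi.single_eq_of_ne (Fin.castSucc_lt_last k).ne' _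
  simp only [Pi.add_apply, Pi.smul_apply, smul_eq_mul, hlast, mul_zero, add_zero,
    add_sub_add_left_eq_sub]
  rw [← Finset.sum_sub_distrib, Finset.sum_eq_single k]
  · simp [mul_sub, add_assoc]
  · intro i _ hik
    have : (Pi.single k.castSucc (1 : ℝ) : Fin (h + 1) → ℝ) i.castSucc = 0 :=
      Pi.single_eq_of_ne (fun e => hik (Fin.castSucc_injective _ e)) _
    simp [this]
  · simp

/-- Local increment bound for the risk in the direction of the `k`-th bias. -/
theorem exists_abs_riskC_sub_le {h : ℕ} (a b : ℝ) {v w : Fin h → ℝ} (hv : ∀ i, 0 < v i)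
    {f p : ℝ → ℝ} (hf : Continuous f) (hp : Continuous p) (k : Fin h) (R : ℝ) :
    ∃ K : ℝ, 0 ≤ K ∧ ∀ θ : Fin (h + 1) → ℝ, ‖θ‖ ≤ R → ∀ s : ℝ, |s| ≤ 1 →
      |riskC a b v w f p (θ + s • Pi.single k.castSucc 1) - riskC a b v w f p θ| ≤
        K * |s| * volume.real (Ioo a b ∩
          {x | -|s| < w k * x + θ k.castSucc ∧ w k * x + θ k.castSucc < 1 + |s|}) := by
  obtain ⟨F, hF⟩ := (isCompact_Icc (a := a) (b := b)).exists_bound_of_continuousOn hf.continuousOn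
  obtain ⟨P, hP⟩ := (isCompact_Icc (a := a) (b := b)).exists_bound_of_continuousOn hp.continuousOn
  set V := ∑ i, v i
  refine ⟨|v k * (2 * R + 1 + 2 * V + 2 * F) * P|, abs_nonneg _, fun θ hθ s hs => ?_⟩
  set θ' : Fin (h + 1) → ℝ := θ + s • Pi.single k.castSucc 1 with hθ'
  set S := Ioo a b ∩
    {x | -|s| < w k * x + θ k.castSucc ∧ w k * x + θ k.castSucc < 1 + |s|}
  have hint : ∀ η : Fin (h + 1) → ℝ,
      IntegrableOn (fun x => (realC v w η x - f x) ^ 2 * p x) (Ioo a b) := fun η =>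
    (((((continuous_realC v w η).sub hf).pow 2).mul hp).integrableOn_Icc).mono_set
      Ioo_subset_Icc_self
  have hSvol : volume S < ⊤ :=
    (measure_mono inter_subset_left).trans_lt (by simp : volume (Ioo a b) < ⊤)
  have hθ'R : ‖θ'‖ ≤ R + 1 := by
    refine (norm_add_le _ _).trans (add_le_add hθ ?_)
    rw [norm_smul, Pi.norm_single, norm_one, mul_one]
    exact hs
  unfold riskC
  rw [← integral_sub (hint θ') (hint θ),
    setIntegral_eq_of_subset_of_forall_sdiff_eq_zero measurableSet_Ioo
      (s := S) inter_subset_left, ← Real.norm_eq_abs]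
  · refine norm_setIntegral_le_of_norm_le_const hSvol fun x hx => ?_
    have hxI := Ioo_subset_Icc_self hx.1
    have hfac : (realC v w θ' x - f x) ^ 2 * p x - (realC v w θ x - f x) ^ 2 * p x =
        (realC v w θ' x - realC v w θ x) *
          (realC v w θ' x + realC v w θ x - 2 * f x) * p x := by ring
    have h1 : |realC v w θ' x - realC v w θ x| ≤ v k * |s| := by
      rw [hθ', realC_add_single_sub, abs_mul, abs_of_pos (hv k)]
      exact mul_le_mul_of_nonneg_left (abs_clipFn_add_sub_le _ _) (hv k).le
    have h2 : |realC v w θ' x + realC v w θ x - 2 * f x| ≤ 2 * R + 1 + 2 * V + 2 * F := by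
      have e1 := abs_le.1 (abs_realC_le hv w θ' x)
      have e2 := abs_le.1 (abs_realC_le hv w θ x)
      have e3 := abs_le.1 (hF x hxI)
      rw [abs_le]
      constructor <;> linarith
    rw [hfac, Real.norm_eq_abs, abs_mul, abs_mul]
    calc _ ≤ v k * |s| * (2 * R + 1 + 2 * V + 2 * F) * P := by
          have := hP x hxI
          rw [Real.norm_eq_abs] at this
          have := mul_nonneg (hv k).le (abs_nonneg s)
          have := (abs_nonneg _).trans h2
          gcongr
      _ = v k * (2 * R + 1 + 2 * V + 2 * F) * P * |s| := by ring
      _ ≤ _ := mul_le_mul_of_nonneg_right (le_abs_self _) (abs_nonneg _)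
  · intro x hx
    have : realC v w θ' x - realC v w θ x = 0 := by
      rw [hθ', realC_add_single_sub]
      have hx' : ¬(-|s| < w k * x + θ k.castSucc ∧ w k * x + θ k.castSucc < 1 + |s|) :=
        fun hc => hx.2 ⟨hx.1, hc⟩
      rcases le_or_gt (w k * x + θ k.castSucc) (-|s|) with hl | hl
      · rw [clipFn_add_eq_of_le hl]; ring
      · rw [clipFn_add_eq_of_ge (not_lt.1 fun hc => hx' ⟨hl, hc⟩)]; ring
    rw [sub_eq_zero.1 this, sub_self]

theorem volume_real_active_le {a b c t s B : ℝ} (hc : 0 < c) (hB : 0 ≤ B) (hs : 0 ≤ s)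
    (hmin : c * b + t ≤ B ∨ 1 - c * a - t ≤ B) :
    volume.real (Ioo a b ∩ {x | -s < c * x + t ∧ c * x + t < 1 + s}) ≤ (B + s) / c := by
  have hnn : 0 ≤ (B + s) / c := by positivity
  rcases hmin with hm | hm
  · calc _ ≤ volume.real (Ioo ((-s - t) / c) b) := by
          refine measureReal_mono (fun x hx => ⟨?_, hx.1.2⟩) (by simp)
          rw [div_lt_iff₀ hc]; linarith [hx.2.1]
      _ ≤ _ := by
          rw [Real.volume_real_Ioo]
          refine max_le ?_ hnn
          rw [le_div_iff₀ hc, sub_mul, div_mul_cancel₀ _ hc.ne']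
          linarith
  · calc _ ≤ volume.real (Ioo a ((1 + s - t) / c)) := by
          refine measureReal_mono (fun x hx => ⟨hx.1.1, ?_⟩) (by simp)
          rw [lt_div_iff₀ hc]; linarith [hx.2.2]
      _ ≤ _ := by
          rw [Real.volume_real_Ioo]
          refine max_le ?_ hnn
          rw [le_div_iff₀ hc, sub_mul, div_mul_cancel₀ _ hc.ne']
          linarith

/-- On bounded sets, the partial derivative of the risk with respect to the `k`-th bias is
controlled by the distance of the activity interval to either end of `(a, b)`. -/
theorem exists_abs_gradC_le {h : ℕ} (a b : ℝ) {v w : Fin h → ℝ} (hv : ∀ i, 0 < v i)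
    (hw : ∀ i, 0 < w i) {f p : ℝ → ℝ} (hf : Continuous f) (hp : Continuous p) (k : Fin h)
    (R : ℝ) :
    ∃ K : ℝ, 0 ≤ K ∧ ∀ θ : Fin (h + 1) → ℝ, ‖θ‖ ≤ R → ∀ B : ℝ, 0 ≤ B →
      (w k * b + θ k.castSucc ≤ B ∨ 1 - w k * a - θ k.castSucc ≤ B) →
        |gradC a b v w f p θ k.castSucc| ≤ K * B := by
  obtain ⟨K, hK, hKb⟩ := exists_abs_riskC_sub_le a b (w := w) hv hf hp k R
  refine ⟨K / w k, div_nonneg hK (hw k).le, fun θ hθ B hB hmin => ?_⟩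
  unfold gradC
  by_cases hd : DifferentiableAt ℝ (riskC a b v w f p) θ
  · have hder := hd.hasFDerivAt.hasLineDerivAt (Pi.single k.castSucc 1)
    unfold HasLineDerivAt at hder
    refine le_of_forall_pos_le_add fun ε hε => ?_
    have hwk := hw k
    have hKw : 0 ≤ K / w k := by positivity
    rw [← Real.norm_eq_abs]
    refine hder.le_of_lip' (by positivity) ?_
    have h1 : ∀ᶠ s : ℝ in 𝓝 0, |s| < 1 := by
      simpa using eventually_abs_sub_lt (0 : ℝ) one_pos
    have h2 : ∀ᶠ s : ℝ in 𝓝 0, |s| < ε / (K / w k + 1) := by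
      simpa using eventually_abs_sub_lt (0 : ℝ) (by positivity : 0 < ε / (K / w k + 1))
    filter_upwards [h1, h2] with s hs1 hs2
    rw [lt_div_iff₀ (by positivity)] at hs2
    rw [zero_smul, add_zero, sub_zero, Real.norm_eq_abs, Real.norm_eq_abs]
    calc _ ≤ _ := hKb θ hθ s hs1.le
      _ ≤ K * |s| * ((B + |s|) / w k) := by
        have := volume_real_active_le hwk hB (abs_nonneg s) hmin
        gcongr
      _ = (K / w k * B + K / w k * |s|) * |s| := by ring
      _ ≤ _ := by
        gcongr
        nlinarith [abs_nonneg s]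
  · rw [fderiv_zero_of_not_differentiableAt hd]
    have := hw k
    simp only [zero_apply, abs_zero]
    positivity

/-- A Grönwall-type positivity principle. -/
theorem pos_of_forall_sub_le_mul {y : ℝ → ℝ} {T C : ℝ} (hT : 0 ≤ T) (hC : 0 ≤ C)
    (hy : ContinuousOn y (Icc 0 T)) (h0 : 0 < y 0)
    (hB : ∀ s t B : ℝ, 0 ≤ s → s ≤ t → t ≤ T → 0 ≤ B → (∀ u ∈ Icc s t, y u ≤ B) →
      y s - y t ≤ C * B * (t - s)) : 0 < y T := by
  by_contra! hneg
  have hcomp : IsCompact (Icc 0 T ∩ y ⁻¹' Iic 0) :=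
    isCompact_Icc.of_isClosed_subset
      (hy.preimage_isClosed_of_isClosed isClosed_Icc isClosed_Iic) inter_subset_left
  obtain ⟨t₀, ⟨⟨ht0, htT⟩, hyt⟩, hleast⟩ := hcomp.exists_isLeast ⟨T, ⟨hT, le_rfl⟩, hneg⟩
  have hyt : y t₀ ≤ 0 := hyt
  have htpos : 0 < t₀ := lt_of_le_of_ne ht0 fun e => by rw [← e] at hyt; linarith
  set δ := (2 * (C + 1))⁻¹ with hδ
  have hδpos : 0 < δ := by positivity
  have hCδ : C * δ < 1 := by
    rw [hδ, ← div_eq_mul_inv, div_lt_one (by positivity)]; linarith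
  set l := max 0 (t₀ - δ)
  have hl0 : 0 ≤ l := le_max_left _ _
  have hlt : l < t₀ := max_lt htpos (by linarith)
  have hyl : 0 < y l := by
    by_contra! hc
    exact absurd (hleast ⟨⟨hl0, hlt.le.trans htT⟩, hc⟩) (not_le.2 hlt)
  obtain ⟨m, hm, hmax⟩ := isCompact_Icc.exists_isMaxOn (nonempty_Icc.2 hlt.le)
    (hy.mono (Icc_subset_Icc hl0 htT))
  have hym : 0 < y m := hyl.trans_le (hmax (left_mem_Icc.2 hlt.le))
  have key := hB m t₀ (y m) (hl0.trans hm.1) hm.2 htT hym.le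
    fun u hu => hmax ⟨hm.1.trans hu.1, hu.2⟩
  have hmδ : t₀ - m ≤ δ := by linarith [hm.1, le_max_right 0 (t₀ - δ)]
  have : C * y m * (t₀ - m) ≤ C * y m * δ := mul_le_mul_of_nonneg_left hmδ (by positivity)
  nlinarith

theorem actI_nonempty_iff {h : ℕ} {a b : ℝ} (hab : a < b) {w : Fin h → ℝ} (hw : ∀ i, 0 < w i)
    (θ : Fin (h + 1) → ℝ) (k : Fin h) :
    (actI a b w θ k).Nonempty ↔
      0 < w k * b + θ k.castSucc ∧ 0 < 1 - w k * a - θ k.castSucc := by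
  have hwk := hw k
  have e1 : psiC w θ k < b ↔ 0 < w k * b + θ k.castSucc := by
    unfold psiC
    rw [div_lt_iff₀ hwk]
    constructor <;> intro <;> linarith
  have e2 : a < psiC w θ k + (w k)⁻¹ ↔ 0 < 1 - w k * a - θ k.castSucc := by
    unfold psiC
    rw [inv_eq_one_div, ← add_div, lt_div_iff₀ hwk]
    constructor <;> intro <;> linarith
  have e3 : psiC w θ k < psiC w θ k + (w k)⁻¹ := lt_add_of_pos_right _ (inv_pos.2 hwk)
  rw [← e1, ← e2, actI, Ioo_inter_Ioo, nonempty_Ioo, max_lt_iff, lt_min_iff, lt_min_iff]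
  tauto

theorem statement_12
    (a b : ℝ) (hab : a < b) (h : ℕ) (hh : 0 < h)
    (v w : Fin h → ℝ) (hv : ∀ i, 0 < v i) (hw : ∀ i, 0 < w i)
    (f p : ℝ → ℝ) (hf : Continuous f) (hp : Continuous p)
    (hpnn : ∀ x : ℝ, 0 ≤ p x) (hsupp : {x : ℝ | 0 < p x} = Set.Ioo a b)
    (Θ : ℝ → Fin (h + 1) → ℝ)
    (hcont : ContinuousOn Θ (Set.Ici 0))
    (hGF : ∀ t : ℝ, 0 ≤ t →
      Θ t = Θ 0 - ∫ s in Set.Icc (0 : ℝ) t, gradC a b v w f p (Θ s))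
    (k : Fin h) (hk : (actI a b w (Θ 0) k).Nonempty) :
    ∀ t : ℝ, 0 ≤ t → (actI a b w (Θ t) k).Nonempty := by
  intro T hT
  by_cases hint : IntegrableOn (fun s => gradC a b v w f p (Θ s)) (Icc 0 T)
  swap
  · rwa [hGF T hT, integral_undef hint, sub_zero]
  obtain ⟨R, hR⟩ := (isCompact_Icc (a := (0 : ℝ)) (b := T)).exists_bound_of_continuousOn
    (hcont.mono Icc_subset_Ici_self)
  obtain ⟨K, hK, hKb⟩ := exists_abs_gradC_le a b hv hw hf hp k R
  have hcoord : ContinuousOn (fun s => Θ s k.castSucc) (Icc 0 T) :=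
    (continuous_apply k.castSucc).comp_continuousOn (hcont.mono Icc_subset_Ici_self)
  have hincr : ∀ s t B : ℝ, 0 ≤ s → s ≤ t → t ≤ T → 0 ≤ B →
      (∀ u ∈ Icc s t, w k * b + Θ u k.castSucc ≤ B ∨ 1 - w k * a - Θ u k.castSucc ≤ B) →
      |Θ s k.castSucc - Θ t k.castSucc| ≤ K * B * (t - s) := by
    intro s t B hs hst htT hB hu
    have hdiff : Θ s - Θ t = ∫ u in Ioc s t, gradC a b v w f p (Θ u) := by
      have hunion : Icc 0 t = Icc 0 s ∪ Ioc s t := (Icc_union_Ioc_eq_Icc hs hst).symm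
      have hdisj : Disjoint (Icc 0 s) (Ioc s t) :=
        Set.disjoint_left.2 fun x hx hx' => absurd hx.2 (not_le.2 hx'.1)
      rw [hGF s hs, hGF t (hs.trans hst), hunion,
        setIntegral_union hdisj measurableSet_Ioc
          (hint.mono_set (Icc_subset_Icc_right (hst.trans htT)))
          (hint.mono_set fun x hx => ⟨hs.trans hx.1.le, hx.2.trans htT⟩)]
      abel
    have hintc : IntegrableOn (fun u => gradC a b v w f p (Θ u)) (Ioc s t) :=
      hint.mono_set fun x hx => ⟨hs.trans hx.1.le, hx.2.trans htT⟩
    have hcomp : Θ s k.castSucc - Θ t k.castSucc =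
        ∫ u in Ioc s t, gradC a b v w f p (Θ u) k.castSucc := by
      rw [← Pi.sub_apply, hdiff]
      exact ((ContinuousLinearMap.proj (R := ℝ) (φ := fun _ : Fin (h + 1) => ℝ)
        k.castSucc).integral_comp_comm hintc).symm
    rw [hcomp, ← Real.norm_eq_abs, ← Real.volume_real_Ioc_of_le hst]
    refine norm_setIntegral_le_of_norm_le_const (by simp) fun u hu' => ?_
    exact hKb _ (hR u ⟨hs.trans hu'.1.le, hu'.2.trans htT⟩) B hB
      (hu u (Ioc_subset_Icc_self hu'))
  rw [actI_nonempty_iff hab hw] at hk ⊢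
  constructor
  · refine pos_of_forall_sub_le_mul (y := fun s => w k * b + Θ s k.castSucc) hT hK
      (continuousOn_const.add hcoord) hk.1 fun s t B hs hst htT hB hu => ?_
    have := (abs_le.1 (hincr s t B hs hst htT hB fun u hm => Or.inl (hu u hm))).2
    simpa using this
  · refine pos_of_forall_sub_le_mul (y := fun s => 1 - w k * a - Θ s k.castSucc) hT hK
      (continuousOn_const.sub hcoord) hk.2 fun s t B hs hst htT hB hu => ?_
    have := (abs_le.1 (hincr s t B hs hst htT hB fun u hm => Or.inr (hu u hm))).1
    linarith
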